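/- arXiv:math/0504553 — 13 statements merged into one kernel-verified Lean document; each statement's English description precedes it below -/
import Mathlib

section
/- Let G be a lattice-ordered abelian group, let u ∈ G, and let p, q ∈ G with 0 ≤ p ≤ u and 0 ≤ q ≤ u. Then ((u - ((p + (u - q)) ⊓ u)) + p) ⊓ u = p ⊔ q. (In the MV-algebra structure on the interval [0,u], where x⊥ = u - x and the MV-sum is x +̂ y = (x + y) ⊓ u, this says (p +̂ q⊥)⊥ +̂ p = p ∨ q.) -/
/-- In a lattice-ordered abelian group `G` with `u : G`, for `p q` in the
interval `[0, u]`, the MV-algebra identity `(p +̂ q⊥)⊥ +̂ p = p ⊔ q` holds,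
where `x⊥ = u - x` and `x +̂ y = (x + y) ⊓ u`. -/
theorem stmt0 {G : Type*} [Lattice G] [AddCommGroup G]
    [CovariantClass G G (· + ·) (· ≤ ·)]
    (u p q : G) (hp0 : 0 ≤ p) (hpu : p ≤ u) (hq0 : 0 ≤ q) (hqu : q ≤ u) :
    ((u - ((p + (u - q)) ⊓ u)) + p) ⊓ u = p ⊔ q := by
  have : AddLeftMono G := ‹CovariantClass G G (· + ·) (· ≤ ·)›
  rw [sub_inf, sub_self, sup_add, zero_add, show u - (p + (u - q)) + p = q by abel,
    sup_comm, inf_eq_left]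
  exact sup_le hpu hqu
end

section
/- Let G be a lattice-ordered abelian group, let u ∈ G, and let p, q, r ∈ G with 0 ≤ p ≤ u, 0 ≤ q ≤ u, and 0 ≤ r ≤ u. Then ((((p + q) ⊓ u) + r) ⊓ u) = ((p + ((q + r) ⊓ u)) ⊓ u). (The truncated addition x +̂ y = (x + y) ⊓ u is associative on the interval [0,u], which is the associativity axiom for the MV-sum in the MV-algebra structure on [0,u].) -/
/-- In a lattice-ordered abelian group `G` with `u : G`, the truncated addition
`x +̂ y = (x + y) ⊓ u` is associative on the interval `[0, u]`. -/
theorem stmt1 {G : Type*} [Lattice G] [AddCommGroup G]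
    [CovariantClass G G (· + ·) (· ≤ ·)]
    (u p q r : G) (hp0 : 0 ≤ p) (hpu : p ≤ u) (hq0 : 0 ≤ q) (hqu : q ≤ u)
    (hr0 : 0 ≤ r) (hru : r ≤ u) :
    (((p + q) ⊓ u) + r) ⊓ u = (p + ((q + r) ⊓ u)) ⊓ u := by
  have : AddLeftMono G := ‹_›
  rw [inf_add, add_inf, inf_assoc, inf_assoc, inf_eq_right.mpr (le_add_of_nonneg_right hr0),
    inf_eq_right.mpr (le_add_of_nonneg_left hp0), add_assoc]
end

section
/- Let G be a lattice-ordered abelian group and let u ∈ G with 0 ≤ u be an order unit for G (i.e., for every g ∈ G there is a positive integer n with g ≤ n • u). Then u is generative: every g ∈ G with 0 ≤ g can be written as a finite sum g = e₁ + e₂ + ⋯ + eₙ with 0 ≤ eᵢ ≤ u for each i. -/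
/-- In a lattice-ordered abelian group, every element of `[0, n • u]` is a sum of elements of
`[0, u]`. -/
theorem exists_list_sum_eq_of_le_nsmul {G : Type*} [Lattice G] [AddCommGroup G] [AddLeftMono G]
    {u : G} (hu : 0 ≤ u) (n : ℕ) {g : G} (hg : 0 ≤ g) (hgn : g ≤ n • u) :
    ∃ l : List G, (∀ e ∈ l, 0 ≤ e ∧ e ≤ u) ∧ l.sum = g := by
  induction n generalizing g with
  | zero => exact ⟨[], by simp, by simpa using le_antisymm hg (by simpa using hgn)⟩
  | succ n ih =>
    have h : g - n • u ≤ g ⊓ u :=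
      le_inf (sub_le_self g (nsmul_nonneg hu n))
        (sub_le_iff_le_add'.2 (by rwa [succ_nsmul] at hgn))
    obtain ⟨l, hl, hsum⟩ := ih (sub_nonneg.2 (inf_le_left : g ⊓ u ≤ g)) (sub_le_comm.1 h)
    refine ⟨(g ⊓ u) :: l, ?_, by simp [hsum]⟩
    simpa using ⟨⟨hg, hu⟩, hl⟩

/-- In a lattice-ordered abelian group `G`, an order unit `u ≥ 0` is
generative: every `g ≥ 0` is a finite sum of elements of the interval
`[0, u]`. -/
theorem stmt5 {G : Type*} [Lattice G] [AddCommGroup G]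
    [CovariantClass G G (· + ·) (· ≤ ·)]
    (u : G) (hu0 : 0 ≤ u) (hu : ∀ g : G, ∃ n : ℕ, 0 < n ∧ g ≤ n • u)
    (g : G) (hg : 0 ≤ g) :
    ∃ l : List G, (∀ e ∈ l, 0 ≤ e ∧ e ≤ u) ∧ l.sum = g := by
  obtain ⟨n, -, hn⟩ := hu g
  exact exists_list_sum_eq_of_le_nsmul hu0 n hg hn
end

section
/- Let G be a lattice-ordered abelian group, let u ∈ G, and let p, e ∈ G with 0 ≤ p ≤ u, 0 ≤ e ≤ u, and p ⊓ (u - p) = 0. Then e = (e ⊓ p) + (e ⊓ (u - p)). (This is the central decomposition of an effect e with respect to a central element p of the interval effect algebra [0,u].) -/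
/-- In a lattice-ordered abelian group `G` with `u : G`, if `p ∈ [0, u]` is
sharp (`p ⊓ (u - p) = 0`), then every `e ∈ [0, u]` decomposes centrally as
`e = (e ⊓ p) + (e ⊓ (u - p))`. -/
theorem stmt6 {G : Type*} [Lattice G] [AddCommGroup G]
    [CovariantClass G G (· + ·) (· ≤ ·)]
    (u p e : G) (hp0 : 0 ≤ p) (hpu : p ≤ u) (he0 : 0 ≤ e) (heu : e ≤ u)
    (hsharp : p ⊓ (u - p) = 0) :
    e = (e ⊓ p) + (e ⊓ (u - p)) := by
  have : AddLeftMono G := ‹CovariantClass G G (· + ·) (· ≤ ·)›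
  apply le_antisymm
  · have hq : 0 ≤ u - p := sub_nonneg.mpr hpu
    rw [← sub_le_iff_le_add]
    refine le_inf (sub_le_self _ (le_inf he0 hq)) ?_
    rw [sub_le_comm]
    exact le_inf (sub_le_self _ hp0) (sub_le_sub_right heu p)
  · rw [← inf_add_sup]
    have hinf : e ⊓ p ⊓ (e ⊓ (u - p)) ≤ 0 :=
      (inf_le_inf inf_le_right inf_le_right).trans hsharp.le
    calc
      _ ≤ 0 + e := add_le_add hinf (sup_le inf_le_left inf_le_left)
      _ = e := zero_add e
end

section
/- Let G be a lattice-ordered abelian group, let u ∈ G, and let p, q ∈ G with 0 ≤ p ≤ u, 0 ≤ q ≤ u, p ⊓ (u - p) = 0, and q ⊓ (u - q) = 0. Then (p ⊓ q) ⊓ (u - (p ⊓ q)) = 0. (The central (sharp) elements of the interval effect algebra [0,u] are closed under the lattice meet, as part of the fact that the center is a Boolean subeffect algebra.) -/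
/-- In a lattice-ordered abelian group `G` with `u : G`, the sharp (central)
elements of `[0, u]` are closed under meet: if `p ⊓ (u - p) = 0` and
`q ⊓ (u - q) = 0`, then `(p ⊓ q) ⊓ (u - (p ⊓ q)) = 0`. -/
theorem stmt7 {G : Type*} [Lattice G] [AddCommGroup G]
    [CovariantClass G G (· + ·) (· ≤ ·)]
    (u p q : G) (hp0 : 0 ≤ p) (hpu : p ≤ u) (hq0 : 0 ≤ q) (hqu : q ≤ u)
    (hp : p ⊓ (u - p) = 0) (hq : q ⊓ (u - q) = 0) :
    (p ⊓ q) ⊓ (u - (p ⊓ q)) = 0 := by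
  have : AddLeftMono G := ‹CovariantClass G G (· + ·) (· ≤ ·)›
  have hle : p + q - u ≤ p ⊓ q := by
    refine le_inf ?_ ?_
    · rw [sub_le_iff_le_add]
      exact add_le_add_right hqu p
    · rw [sub_le_iff_le_add, add_comm p q]
      exact add_le_add_right hpu q
  refine le_antisymm ?_ (le_inf (le_inf hp0 hq0) (sub_nonneg.2 (inf_le_left.trans hpu)))
  set e := (p ⊓ q) ⊓ (u - (p ⊓ q))
  have hep : e ≤ p := inf_le_left.trans inf_le_left
  have heq : e ≤ q := inf_le_left.trans inf_le_right
  have hsum : e ≤ (u - p) + (u - q) :=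
    calc e ≤ u - (p ⊓ q) := inf_le_right
      _ ≤ u - (p + q - u) := sub_le_sub_left hle u
      _ = (u - p) + (u - q) := by abel
  have hsub : e - (u - q) ≤ 0 := by
    rw [← hp]
    exact le_inf ((sub_le_self e (sub_nonneg.2 hqu)).trans hep) (sub_le_iff_le_add.2 hsum)
  rw [← hq]
  exact le_inf heq (sub_nonpos.1 hsub)
end

section
/- Let G be a lattice-ordered abelian group, let u ∈ G with 0 ≤ u, and suppose the interval [0,u] carries a Heyting conditional, i.e., a map ⊃ assigning to q, r ∈ [0,u] an element (q ⊃ r) ∈ [0,u] such that for all p, q, r ∈ [0,u], p ⊓ q ≤ r if and only if p ≤ (q ⊃ r). Then for every e ∈ [0,u], the Heyting negation e′ := (e ⊃ 0) satisfies e′ ≤ u - e (the Heyting negation is below the effect-algebra supplement). -/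
/-- Let `G` be a lattice-ordered abelian group, `0 ≤ u`, and suppose the
interval `[0, u]` carries a Heyting conditional `himp`. Then for every
`e ∈ [0, u]`, the Heyting negation `e′ = (e ⊃ 0)` satisfies `e′ ≤ u - e`. -/
theorem stmt8 {G : Type*} [Lattice G] [AddCommGroup G]
    [CovariantClass G G (· + ·) (· ≤ ·)]
    (u : G) (hu0 : 0 ≤ u) (himp : G → G → G)
    (hmem : ∀ q r : G, 0 ≤ q → q ≤ u → 0 ≤ r → r ≤ u →
      0 ≤ himp q r ∧ himp q r ≤ u)
    (hadj : ∀ p q r : G, 0 ≤ p → p ≤ u → 0 ≤ q → q ≤ u → 0 ≤ r → r ≤ u →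
      (p ⊓ q ≤ r ↔ p ≤ himp q r))
    (e : G) (he0 : 0 ≤ e) (heu : e ≤ u) :
    himp e 0 ≤ u - e := by
  obtain ⟨h0, hu⟩ := hmem e 0 he0 heu le_rfl hu0
  have hinf : himp e 0 ⊓ e ≤ 0 :=
    (hadj (himp e 0) e 0 h0 hu he0 heu le_rfl hu0).2 le_rfl
  rw [le_sub_iff_add_le, ← inf_add_sup]
  exact (add_le_add hinf (sup_le hu heu)).trans_eq (zero_add u)
end

section
/- Let G be a lattice-ordered abelian group, let u ∈ G with 0 ≤ u, and suppose the interval [0,u] carries a Heyting conditional, i.e., a map ⊃ assigning to q, r ∈ [0,u] an element (q ⊃ r) ∈ [0,u] such that for all p, q, r ∈ [0,u], p ⊓ q ≤ r if and only if p ≤ (q ⊃ r). Then for every e ∈ [0,u], the Heyting negation e′ := (e ⊃ 0) satisfies e′ = u - e if and only if e ⊓ (u - e) = 0 (i.e., the Heyting negation equals the supplement exactly for the central elements). -/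
/-- Let `G` be a lattice-ordered abelian group, `0 ≤ u`, and suppose the
interval `[0, u]` carries a Heyting conditional `himp`. Then for every
`e ∈ [0, u]`, the Heyting negation `e′ = (e ⊃ 0)` equals the supplement
`u - e` iff `e ⊓ (u - e) = 0`, i.e. iff `e` is central. -/
theorem stmt9 {G : Type*} [Lattice G] [AddCommGroup G]
    [CovariantClass G G (· + ·) (· ≤ ·)]
    (u : G) (hu0 : 0 ≤ u) (himp : G → G → G)
    (hmem : ∀ q r : G, 0 ≤ q → q ≤ u → 0 ≤ r → r ≤ u →
      0 ≤ himp q r ∧ himp q r ≤ u)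
    (hadj : ∀ p q r : G, 0 ≤ p → p ≤ u → 0 ≤ q → q ≤ u → 0 ≤ r → r ≤ u →
      (p ⊓ q ≤ r ↔ p ≤ himp q r))
    (e : G) (he0 : 0 ≤ e) (heu : e ≤ u) :
    himp e 0 = u - e ↔ e ⊓ (u - e) = 0 := by
  have hs0 : 0 ≤ u - e := sub_nonneg.mpr heu
  have hsu : u - e ≤ u := sub_le_self u he0
  obtain ⟨hn0, hnu⟩ := hmem e 0 he0 heu le_rfl hu0
  constructor
  · intro h
    have hle := (hadj (u - e) e 0 hs0 hsu he0 heu le_rfl hu0).mpr h.ge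
    exact le_antisymm (inf_comm e (u - e) ▸ hle) (le_inf he0 hs0)
  · intro h
    apply le_antisymm
    · have hle := (hadj (himp e 0) e 0 hn0 hnu he0 heu le_rfl hu0).mpr le_rfl
      have hinf : himp e 0 ⊓ e = 0 := le_antisymm hle (le_inf hn0 he0)
      have hsum := inf_add_sup (himp e 0) e
      rw [hinf, zero_add] at hsum
      exact le_sub_iff_add_le.mpr (hsum ▸ sup_le hnu heu)
    · exact (hadj (u - e) e 0 hs0 hsu he0 heu le_rfl hu0).mp
        (inf_comm e (u - e) ▸ h.le)
end

section
/- Let G be a lattice-ordered abelian group, let u ∈ G with 0 ≤ u, and suppose the interval [0,u] carries a Heyting conditional, i.e., a map ⊃ assigning to q, r ∈ [0,u] an element (q ⊃ r) ∈ [0,u] such that for all p, q, r ∈ [0,u], p ⊓ q ≤ r if and only if p ≤ (q ⊃ r). Then for every e ∈ [0,u], the Heyting negation e′ := (e ⊃ 0) satisfies e′ ⊓ (u - e′) = 0 (i.e., every Heyting negation is a central element of the effect algebra [0,u]). -/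
/-- Let `G` be a lattice-ordered abelian group, `0 ≤ u`, and suppose the
interval `[0, u]` carries a Heyting conditional `himp`. Then for every
`e ∈ [0, u]`, the Heyting negation `e′ = (e ⊃ 0)` is a central element of
the effect algebra `[0, u]`: `e′ ⊓ (u - e′) = 0`. -/
theorem stmt10 {G : Type*} [Lattice G] [AddCommGroup G]
    [CovariantClass G G (· + ·) (· ≤ ·)]
    (u : G) (hu0 : 0 ≤ u) (himp : G → G → G)
    (hmem : ∀ q r : G, 0 ≤ q → q ≤ u → 0 ≤ r → r ≤ u →
      0 ≤ himp q r ∧ himp q r ≤ u)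
    (hadj : ∀ p q r : G, 0 ≤ p → p ≤ u → 0 ≤ q → q ≤ u → 0 ≤ r → r ≤ u →
      (p ⊓ q ≤ r ↔ p ≤ himp q r))
    (e : G) (he0 : 0 ≤ e) (heu : e ≤ u) :
    himp e 0 ⊓ (u - himp e 0) = 0 := by
  obtain ⟨hn0, hnu⟩ := hmem e 0 he0 heu le_rfl hu0
  have adj := fun p h0 hu => hadj p e 0 h0 hu he0 heu le_rfl hu0
  generalize himp e 0 = n at *
  have hne : n ⊓ e ≤ 0 := (adj n hn0 hnu).2 le_rfl
  have double_le : (n + n) ⊓ u ≤ n := by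
    refine (adj _ (le_inf (add_nonneg hn0 hn0) hu0) inf_le_right).1 ?_
    have h_le_n : (n + n) ⊓ u ⊓ e ≤ n := by
      refine sub_nonpos.1 (le_trans (le_inf ?_ ?_) hne)
      · exact sub_le_iff_le_add.2 (inf_le_left.trans inf_le_left)
      · exact (sub_le_self _ hn0).trans inf_le_right
    exact (le_inf h_le_n inf_le_right).trans hne
  refine le_antisymm ?_ (le_inf hn0 (sub_nonneg.2 hnu))
  have h : n + n ⊓ (u - n) ≤ n := by
    refine le_trans (le_inf ?_ ?_) double_le
    · exact add_le_add_right inf_le_left n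
    · exact (add_le_add_right inf_le_right n).trans_eq (add_sub_cancel n u)
  exact nonpos_of_add_le_right h
end

section
/- Let G be a lattice-ordered abelian group, let u ∈ G with 0 ≤ u, and suppose the interval [0,u] carries a Heyting conditional, i.e., a map ⊃ assigning to q, r ∈ [0,u] an element (q ⊃ r) ∈ [0,u] such that for all p, q, r ∈ [0,u], p ⊓ q ≤ r if and only if p ≤ (q ⊃ r). Then [0,u] is a Stone-Heyting algebra: for every e ∈ [0,u], writing e′ := (e ⊃ 0) and e″ := (e′ ⊃ 0), one has e′ ⊔ e″ = u. -/
/-- Let `G` be a lattice-ordered abelian group, `0 ≤ u`, and suppose the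
interval `[0, u]` carries a Heyting conditional `himp`. Then `[0, u]` is a
Stone-Heyting algebra: for every `e ∈ [0, u]`, with `e′ = (e ⊃ 0)` and
`e″ = (e′ ⊃ 0)`, one has `e′ ⊔ e″ = u`. -/
theorem stmt11 {G : Type*} [Lattice G] [AddCommGroup G]
    [CovariantClass G G (· + ·) (· ≤ ·)]
    (u : G) (hu0 : 0 ≤ u) (himp : G → G → G)
    (hmem : ∀ q r : G, 0 ≤ q → q ≤ u → 0 ≤ r → r ≤ u →
      0 ≤ himp q r ∧ himp q r ≤ u)
    (hadj : ∀ p q r : G, 0 ≤ p → p ≤ u → 0 ≤ q → q ≤ u → 0 ≤ r → r ≤ u →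
      (p ⊓ q ≤ r ↔ p ≤ himp q r))
    (e : G) (he0 : 0 ≤ e) (heu : e ≤ u) :
    himp e 0 ⊔ himp (himp e 0) 0 = u := by
  obtain ⟨ha0, hau⟩ := hmem e 0 he0 heu le_rfl hu0
  have hle : ∀ p, 0 ≤ p → p ≤ u → (p ⊓ e ≤ 0 ↔ p ≤ himp e 0) :=
    fun p hp0 hpu => hadj p e 0 hp0 hpu he0 heu le_rfl hu0
  have hdisj := (hle (himp e 0) ha0 hau).2 le_rfl
  obtain ⟨-, hbu⟩ := hmem (himp e 0) 0 ha0 hau le_rfl hu0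
  have hadj' := hadj (u - himp e 0) (himp e 0) 0 (sub_nonneg.2 hau) (sub_le_self u ha0)
    ha0 hau le_rfl hu0
  generalize himp e 0 = a at *
  have hx0 : 0 ≤ a ⊓ (u - a) := le_inf ha0 (sub_nonneg.2 hau)
  -- `a + a ⊓ (u - a)`, the truncated double of `a`, is still disjoint from `e`.
  have hdouble : (a + a ⊓ (u - a)) ⊓ e ≤ 0 := by
    have h₁ : (a + a ⊓ (u - a)) ⊓ e - a ⊓ (u - a) ≤ 0 :=
      (le_inf (sub_le_iff_le_add.2 inf_le_left)
        ((sub_le_self _ hx0).trans inf_le_right)).trans hdisj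
    exact (le_inf ((sub_nonpos.1 h₁).trans inf_le_left) inf_le_right).trans hdisj
  have hsum : a + a ⊓ (u - a) ≤ u :=
    (add_le_add_right inf_le_right a).trans_eq (add_sub_cancel a u)
  have hcompl : a ⊓ (u - a) ≤ 0 := by
    simpa using (hle _ (add_nonneg ha0 hx0) hsum).1 hdouble
  have hsup : a ⊔ (u - a) = u := by
    have h := inf_add_sup a (u - a)
    rwa [le_antisymm hcompl hx0, zero_add, add_sub_cancel] at h
  refine le_antisymm (sup_le hau hbu) ?_
  calc u = a ⊔ (u - a) := hsup.symm
    _ ≤ a ⊔ himp a 0 := sup_le_sup_left (hadj'.1 (inf_comm a (u - a) ▸ hcompl)) a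
end

section
/- Let A be a lattice-ordered abelian group, let u ∈ A with 0 ≤ u be an order unit for A (for every g ∈ A there is a positive integer n with g ≤ n • u), and suppose the interval [0,u] carries a Heyting conditional, i.e., a map ⊃ assigning to q, r ∈ [0,u] an element (q ⊃ r) ∈ [0,u] such that for all p, q, r ∈ [0,u], p ⊓ q ≤ r if and only if p ≤ (q ⊃ r). Then for every v ∈ A with 0 ≤ v and v ≠ 0, the interval [0,v] also carries a Heyting conditional: there exists a map c : [0,v] × [0,v] → [0,v] such that for all p, q, r ∈ [0,v], p ⊓ q ≤ r if and only if p ≤ c(q, r). -/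
section LatticeOrderedGroup

variable {A : Type*} [Lattice A] [AddCommGroup A] [CovariantClass A A (· + ·) (· ≤ ·)]

theorem inf_add_le_inf_add_inf {x y z : A} (hx : 0 ≤ x) (hy : 0 ≤ y) (hz : 0 ≤ z) :
    x ⊓ (y + z) ≤ x ⊓ y + x ⊓ z := by
  rw [add_inf, inf_add, inf_add]
  refine le_inf (le_inf ?_ ?_) (le_inf ?_ inf_le_right)
  · exact inf_le_left.trans (le_add_of_nonneg_left hx)
  · exact inf_le_left.trans (le_add_of_nonneg_left hy)
  · exact inf_le_left.trans (le_add_of_nonneg_right hz)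

theorem inf_nsmul_le_nsmul_inf {x y : A} (hx : 0 ≤ x) (hy : 0 ≤ y) (n : ℕ) :
    x ⊓ n • y ≤ n • (x ⊓ y) := by
  induction n with
  | zero => simp
  | succ n ih =>
    rw [succ_nsmul, succ_nsmul]
    exact (inf_add_le_inf_add_inf hx (nsmul_nonneg hy n) hy).trans (add_le_add_left ih _)

/-- If every element of `[0, u]` has a pseudocomplement in `[0, u]`, for an order unit `u`, then
among the elements of any interval `[0, w]` disjoint from a given `a ≥ 0` there is a largest. -/
theorem exists_greatest_disjoint_of_orderUnit {u : A} (hu0 : 0 ≤ u)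
    (hu : ∀ g : A, ∃ n : ℕ, 0 < n ∧ g ≤ n • u)
    (hpc : ∀ b : A, 0 ≤ b → b ≤ u →
      ∃ b' : A, 0 ≤ b' ∧ b' ≤ u ∧ ∀ x, 0 ≤ x → x ≤ u → (x ⊓ b ≤ 0 ↔ x ≤ b'))
    {a w : A} (ha : 0 ≤ a) (hw : 0 ≤ w) :
    ∃ m : A, 0 ≤ m ∧ m ≤ w ∧ ∀ x, 0 ≤ x → x ≤ w → (x ⊓ a ≤ 0 ↔ x ≤ m) := by
  obtain ⟨b', hb0, hbu, hb⟩ := hpc (a ⊓ u) (le_inf ha hu0) inf_le_right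
  obtain ⟨n, -, hn⟩ := hu w
  obtain ⟨k, -, hk⟩ := hu a
  refine ⟨w ⊓ n • b', le_inf hw (nsmul_nonneg hb0 n), inf_le_left, fun x hx hxw => ⟨?_, ?_⟩⟩
  · intro h
    refine le_inf hxw ?_
    have hxu : x ⊓ u ≤ b' := (hb _ (le_inf hx hu0) inf_le_right).1 <|
      (inf_le_inf inf_le_left inf_le_left).trans h
    calc x = x ⊓ n • u := (inf_eq_left.2 (hxw.trans hn)).symm
      _ ≤ n • (x ⊓ u) := inf_nsmul_le_nsmul_inf hx hu0 n
      _ ≤ n • b' := nsmul_le_nsmul_right hxu n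
  · intro h
    have hab : a ⊓ b' ≤ 0 := by
      have h0 : a ⊓ b' ⊓ u ≤ 0 := by
        rw [inf_right_comm, inf_comm]
        exact (hb b' hb0 hbu).2 le_rfl
      calc a ⊓ b' = a ⊓ b' ⊓ k • u := (inf_eq_left.2 (inf_le_left.trans hk)).symm
        _ ≤ k • (a ⊓ b' ⊓ u) := inf_nsmul_le_nsmul_inf (le_inf ha hb0) hu0 k
        _ ≤ 0 := nsmul_nonpos h0 k
    calc x ⊓ a ≤ a ⊓ n • b' := le_inf inf_le_right (inf_le_left.trans (h.trans inf_le_right))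
      _ ≤ n • (a ⊓ b') := inf_nsmul_le_nsmul_inf ha hb0 n
      _ ≤ 0 := nsmul_nonpos hab n

theorem inf_le_iff_sub_sup_zero_inf_le_zero (p q r : A) :
    p ⊓ q ≤ r ↔ ((p - r) ⊔ 0) ⊓ ((q - r) ⊔ 0) ≤ 0 := by
  let _ : DistribLattice A := AddCommGroup.toDistribLattice A
  have h : ((p - r) ⊔ 0) ⊓ ((q - r) ⊔ 0) = (p ⊓ q - r) ⊔ 0 := by
    rw [inf_sub]
    exact (sup_inf_right (p - r) (q - r) 0).symm
  rw [h, sup_le_iff, sub_nonpos]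
  simp

end LatticeOrderedGroup


/-- (Ritter) Let `A` be a lattice-ordered abelian group with order unit
`u ≥ 0` whose interval `[0, u]` carries a Heyting conditional. Then for every
`v ∈ A⁺` with `v ≠ 0`, the interval `[0, v]` also carries a Heyting
conditional. -/
theorem stmt12 {A : Type*} [Lattice A] [AddCommGroup A]
    [CovariantClass A A (· + ·) (· ≤ ·)]
    (u : A) (hu0 : 0 ≤ u) (hu : ∀ g : A, ∃ n : ℕ, 0 < n ∧ g ≤ n • u)
    (himp : A → A → A)
    (hmem : ∀ q r : A, 0 ≤ q → q ≤ u → 0 ≤ r → r ≤ u →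
      0 ≤ himp q r ∧ himp q r ≤ u)
    (hadj : ∀ p q r : A, 0 ≤ p → p ≤ u → 0 ≤ q → q ≤ u → 0 ≤ r → r ≤ u →
      (p ⊓ q ≤ r ↔ p ≤ himp q r))
    (v : A) (hv0 : 0 ≤ v) (hv : v ≠ 0) :
    ∃ c : A → A → A,
      (∀ q r : A, 0 ≤ q → q ≤ v → 0 ≤ r → r ≤ v →
        0 ≤ c q r ∧ c q r ≤ v) ∧
      (∀ p q r : A, 0 ≤ p → p ≤ v → 0 ≤ q → q ≤ v → 0 ≤ r → r ≤ v →
        (p ⊓ q ≤ r ↔ p ≤ c q r)) := by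
  have hpc : ∀ b : A, 0 ≤ b → b ≤ u →
      ∃ b' : A, 0 ≤ b' ∧ b' ≤ u ∧ ∀ x, 0 ≤ x → x ≤ u → (x ⊓ b ≤ 0 ↔ x ≤ b') :=
    fun b hb hbu => ⟨himp b 0, (hmem b 0 hb hbu le_rfl hu0).1, (hmem b 0 hb hbu le_rfl hu0).2,
      fun x hx hxu => hadj x b 0 hx hxu hb hbu le_rfl hu0⟩
  have key : ∀ q r : A, ∃ m : A, r ≤ v → 0 ≤ m ∧ m ≤ v - r ∧
      ∀ x, 0 ≤ x → x ≤ v - r → (x ⊓ ((q - r) ⊔ 0) ≤ 0 ↔ x ≤ m) := by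
    intro q r
    by_cases hr : r ≤ v
    · obtain ⟨m, hm⟩ := exists_greatest_disjoint_of_orderUnit hu0 hu hpc
        (le_sup_right : 0 ≤ (q - r) ⊔ 0) (sub_nonneg.2 hr)
      exact ⟨m, fun _ => hm⟩
    · exact ⟨0, fun h => absurd h hr⟩
  choose m hm using key
  refine ⟨fun q r => r + m q r, fun q r _ _ hr hrv => ?_, fun p q r _ hpv _ _ _ hrv => ?_⟩
  · obtain ⟨h0, h1, -⟩ := hm q r hrv
    exact ⟨add_nonneg hr h0, le_sub_iff_add_le'.1 h1⟩
  · obtain ⟨h0, -, h2⟩ := hm q r hrv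
    rw [inf_le_iff_sub_sup_zero_inf_le_zero, h2 _ le_sup_right
      (sup_le (sub_le_sub_right hpv r) (sub_nonneg.2 hrv)), sup_le_iff, sub_le_iff_le_add']
    exact and_iff_left h0
end

section
/- Let H be a complex Hilbert space and let P and Q be projections on H, i.e., continuous linear operators with P = P* (self-adjoint), P ∘ P = P, Q = Q*, and Q ∘ Q = Q. Then P ∘ Q = Q ∘ P if and only if P and Q are Mackey compatible, i.e., there exist projections P₁, Q₁, R on H that are pairwise orthogonal (P₁ ∘ Q₁ = 0, P₁ ∘ R = 0, Q₁ ∘ R = 0) such that P = P₁ + R and Q = Q₁ + R. -/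
/-- If the product of two self-adjoint elements vanishes, so does the product in the other order. -/
theorem IsSelfAdjoint.mul_eq_zero_symm {A : Type*} [NonUnitalRing A] [StarRing A] {a b : A}
    (ha : IsSelfAdjoint a) (hb : IsSelfAdjoint b) (h : a * b = 0) : b * a = 0 := by
  have := congrArg star h
  rwa [star_mul, ha.star_eq, hb.star_eq, star_zero] at this


/-- Two projections `P`, `Q` on a complex Hilbert space commute iff they are
Mackey compatible, i.e. there are pairwise orthogonal projections `P₁`, `Q₁`,
`R` with `P = P₁ + R` and `Q = Q₁ + R`. -/
theorem stmt14 {H : Type*} [NormedAddCommGroup H] [InnerProductSpace ℂ H]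
    [CompleteSpace H] (P Q : H →L[ℂ] H)
    (hP : IsSelfAdjoint P) (hP2 : P ∘L P = P)
    (hQ : IsSelfAdjoint Q) (hQ2 : Q ∘L Q = Q) :
    P ∘L Q = Q ∘L P ↔
      ∃ P₁ Q₁ R : H →L[ℂ] H,
        IsSelfAdjoint P₁ ∧ P₁ ∘L P₁ = P₁ ∧
        IsSelfAdjoint Q₁ ∧ Q₁ ∘L Q₁ = Q₁ ∧
        IsSelfAdjoint R ∧ R ∘L R = R ∧
        P₁ ∘L Q₁ = 0 ∧ P₁ ∘L R = 0 ∧ Q₁ ∘L R = 0 ∧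
        P = P₁ + R ∧ Q = Q₁ + R := by
  simp only [← ContinuousLinearMap.mul_def] at *
  constructor
  · intro h
    have hPR : P * (P * Q) = P * Q := by rw [← mul_assoc, hP2]
    have hRQ : P * Q * Q = P * Q := by rw [mul_assoc, hQ2]
    have hRP : P * Q * P = P * Q := by rw [mul_assoc, ← h, hPR]
    have hQR : Q * (P * Q) = P * Q := by rw [← mul_assoc, ← h, hRQ]
    have hRR : P * Q * (P * Q) = P * Q := by rw [mul_assoc, hQR, hPR]
    have hR : IsSelfAdjoint (P * Q) := (hP.commute_iff hQ).mp h
    refine ⟨P - P * Q, Q - P * Q, P * Q, hP.sub hR, ?_, hQ.sub hR, ?_, hR, hRR, ?_, ?_, ?_,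
      (sub_add_cancel _ _).symm, (sub_add_cancel _ _).symm⟩ <;>
    simp only [mul_sub, sub_mul, hP2, hQ2, hPR, hRQ, hRP, hQR, hRR, sub_self, sub_zero]
  · rintro ⟨P₁, Q₁, R, hP₁, -, hQ₁, -, hR, -, hPQ, hPR, hQR, rfl, rfl⟩
    simp only [add_mul, mul_add, hPQ, hPR, hQR, hP₁.mul_eq_zero_symm hQ₁ hPQ,
      hP₁.mul_eq_zero_symm hR hPR, hQ₁.mul_eq_zero_symm hR hQR]
end

section
/- Let H be a complex Hilbert space and let A be an effect operator on H, i.e., a continuous linear self-adjoint operator with 0 ≤ A ≤ 1 in the Loewner order. Then A is a projection (A ∘ A = A) if and only if A ∧ A⊥ = 0 in the sense that the only effect operator below both A and 1 - A is zero: for every continuous linear self-adjoint operator B with 0 ≤ B, B ≤ A, and B ≤ 1 - A, one has B = 0. -/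
/-- If `0 ≤ b ≤ t`, then `b` annihilates everything that `t` annihilates. -/
theorem mul_eq_zero_of_nonneg_of_le {R : Type*} [CStarAlgebra R] [PartialOrder R]
    [StarOrderedRing R] {b t c : R} (hb : 0 ≤ b) (hbt : b ≤ t) (htc : t * c = 0) :
    b * c = 0 := by
  have hle : star c * b * c ≤ 0 := by
    simpa [mul_assoc, htc] using star_left_conjugate_le_conjugate hbt c
  have hzero : star c * b * c = 0 := le_antisymm hle (star_left_conjugate_nonneg hb c)
  have hsqrt : CFC.sqrt b * CFC.sqrt b = b := CFC.sqrt_mul_sqrt_self b hb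
  have hstar : star (CFC.sqrt b) = CFC.sqrt b :=
    (IsSelfAdjoint.of_nonneg (CFC.sqrt_nonneg b)).star_eq
  have hc : CFC.sqrt b * c = 0 := by
    rw [← CStarRing.star_mul_self_eq_zero_iff, star_mul, hstar, mul_assoc,
      ← mul_assoc (CFC.sqrt b), hsqrt, ← mul_assoc, hzero]
  rw [← hsqrt, mul_assoc, hc, mul_zero]

/-- An element `a` of a unital C⋆-algebra with `0 ≤ a ≤ 1` is idempotent iff `0` is the only
nonnegative element below both `a` and `1 - a`. -/
theorem isIdempotentElem_iff_forall_le_eq_zero {R : Type*} [CStarAlgebra R] [PartialOrder R]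
    [StarOrderedRing R] {a : R} (ha0 : 0 ≤ a) (ha1 : a ≤ 1) :
    IsIdempotentElem a ↔ ∀ b : R, 0 ≤ b → b ≤ a → b ≤ 1 - a → b = 0 := by
  constructor
  · intro h b hb hba hba'
    have h1 : b * (1 - a) = 0 := mul_eq_zero_of_nonneg_of_le hb hba h.mul_one_sub_self
    have h2 : b * a = 0 := mul_eq_zero_of_nonneg_of_le hb hba' h.one_sub_mul_self
    simpa [mul_sub, h2] using h1
  · intro h
    have hsa : IsSelfAdjoint a := .of_nonneg ha0
    have hb : a * (1 - a) = 0 := by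
      refine h _ (Commute.mul_nonneg ha0 (sub_nonneg.2 ha1)
        ((Commute.one_right a).sub_right (.refl a))) ?_ ?_
      · rw [← sub_nonneg]
        convert hsa.mul_self_nonneg using 1
        noncomm_ring
      · rw [← sub_nonneg]
        convert ((IsSelfAdjoint.one R).sub hsa).mul_self_nonneg using 1
        noncomm_ring
    rw [mul_sub, mul_one, sub_eq_zero] at hb
    exact hb.symm

/-- An effect operator `A` on a complex Hilbert space (a continuous linear
self-adjoint operator with `0 ≤ A ≤ 1` in the Loewner order) is a projection
iff `A ∧ A⊥ = 0`: the only effect operator below both `A` and `1 - A` is `0`.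
Here `0 ≤ S` is expressed as `S.IsPositive` and `S ≤ T` as
`(T - S).IsPositive`. -/
theorem stmt15 {H : Type*} [NormedAddCommGroup H] [InnerProductSpace ℂ H]
    [CompleteSpace H] (A : H →L[ℂ] H)
    (hA : IsSelfAdjoint A) (hA0 : A.IsPositive) (hA1 : (1 - A).IsPositive) :
    A ∘L A = A ↔
      ∀ B : H →L[ℂ] H, IsSelfAdjoint B → B.IsPositive →
        (A - B).IsPositive → ((1 - A) - B).IsPositive → B = 0 := by
  simp only [← ContinuousLinearMap.nonneg_iff_isPositive, sub_nonneg] at hA0 hA1 ⊢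
  exact (isIdempotentElem_iff_forall_le_eq_zero hA0 hA1).trans
    ⟨fun h B _ => h B, fun h B hB => h B (.of_nonneg hB) hB⟩
end

section
/- Let B be a Boolean algebra and let μ : B → ℝ be a finitely additive probability measure, i.e., μ(x) ≥ 0 for all x ∈ B, μ(⊤) = 1, and μ(x ⊔ y) = μ(x) + μ(y) whenever x ⊓ y = ⊥. Then μ is an extreme point of the convex set of finitely additive probability measures on B — i.e., whenever μ = t • μ₁ + (1 - t) • μ₂ with 0 < t < 1 and μ₁, μ₂ finitely additive probability measures on B, one has μ₁ = μ₂ = μ — if and only if μ takes only the values 0 and 1. -/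
/-- A finitely additive probability measure on a Boolean algebra `B`. -/
def IsFinAddProb {B : Type*} [BooleanAlgebra B] (μ : B → ℝ) : Prop :=
  (∀ x : B, 0 ≤ μ x) ∧ μ ⊤ = 1 ∧
    ∀ x y : B, x ⊓ y = ⊥ → μ (x ⊔ y) = μ x + μ y

namespace IsFinAddProb

variable {B : Type*} [BooleanAlgebra B] {μ : B → ℝ}

theorem inf_add_inf_compl (hμ : IsFinAddProb μ) (x y : B) :
    μ (y ⊓ x) + μ (y ⊓ xᶜ) = μ y := by
  rw [← hμ.2.2 _ _ (by rw [← inf_inf_distrib_left, inf_compl_self, inf_bot_eq]),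
    ← inf_sup_left, sup_compl_eq_top, inf_top_eq]

theorem add_compl (hμ : IsFinAddProb μ) (x : B) : μ x + μ xᶜ = 1 := by
  simpa [hμ.2.1] using hμ.inf_add_inf_compl x ⊤

theorem le_one (hμ : IsFinAddProb μ) (x : B) : μ x ≤ 1 := by
  linarith [hμ.add_compl x, hμ.1 xᶜ]

/-- Conditioning on an element of nonzero measure. -/
theorem cond (hμ : IsFinAddProb μ) {x : B} (hx : μ x ≠ 0) :
    IsFinAddProb fun y => μ (y ⊓ x) / μ x := by
  refine ⟨fun y => div_nonneg (hμ.1 _) (hμ.1 _), by simp [hx], fun y z hyz => ?_⟩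
  have h : (y ⊓ x) ⊓ (z ⊓ x) = ⊥ := by rw [← inf_inf_distrib_right, hyz, bot_inf_eq]
  simp only [inf_sup_right, hμ.2.2 _ _ h, add_div]

end IsFinAddProb

/-- A finitely additive probability measure `μ` on a Boolean algebra `B` is an
extreme point of the convex set of finitely additive probability measures on
`B` iff `μ` takes only the values `0` and `1`. -/
theorem stmt17 {B : Type*} [BooleanAlgebra B] (μ : B → ℝ) (hμ : IsFinAddProb μ) :
    (∀ (t : ℝ) (μ₁ μ₂ : B → ℝ), 0 < t → t < 1 →
        IsFinAddProb μ₁ → IsFinAddProb μ₂ → μ = t • μ₁ + (1 - t) • μ₂ →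
        μ₁ = μ ∧ μ₂ = μ) ↔
      ∀ x : B, μ x = 0 ∨ μ x = 1 := by
  constructor
  · intro h x
    by_contra! hx
    have hc := hμ.add_compl x
    have hx0 : 0 < μ x := (hμ.1 x).lt_of_ne' hx.1
    have hx1 : μ x < 1 := (hμ.le_one x).lt_of_ne hx.2
    have hc0 : μ xᶜ ≠ 0 := by linarith
    have key := (h (μ x) _ _ hx0 hx1 (hμ.cond hx.1) (hμ.cond hc0) (by
      funext y
      simp only [Pi.add_apply, Pi.smul_apply, smul_eq_mul]
      rw [← eq_sub_of_add_eq' hc, mul_div_cancel₀ _ hx.1, mul_div_cancel₀ _ hc0,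
        hμ.inf_add_inf_compl])).1
    have hkey := congrFun key x
    simp only [inf_idem, div_self hx.1] at hkey
    exact hx.2 hkey.symm
  · intro h t μ₁ μ₂ ht0 ht1 h₁ h₂ he
    have hs : 0 < 1 - t := sub_pos.2 ht1
    suffices ∀ x, μ₁ x = μ x ∧ μ₂ x = μ x from
      ⟨funext fun x => (this x).1, funext fun x => (this x).2⟩
    intro x
    have hx : μ x = t * μ₁ x + (1 - t) * μ₂ x := congrFun he x
    rcases h x with h0 | h1
    · rw [h0] at hx ⊢
      constructor <;> nlinarith [h₁.1 x, h₂.1 x, mul_nonneg ht0.le (h₁.1 x),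
        mul_nonneg hs.le (h₂.1 x)]
    · rw [h1] at hx ⊢
      have a := sub_nonneg.2 (h₁.le_one x)
      have b := sub_nonneg.2 (h₂.le_one x)
      constructor <;> nlinarith [mul_nonneg ht0.le a, mul_nonneg hs.le b]
end
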